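/- The base polytope of a matroid M contains the constant point (ρ⁻¹, ..., ρ⁻¹), where ρ = |E|/rank(M), if and only if ρ(A) ≤ ρ(E) for all nonempty A ⊆ E. -/

import Mathlib

open Finset

variable {α : Type*} [DecidableEq α]

/-- A collection of bases of a (loopful-permitting) matroid on ground set `E`:
nonempty, contained in `E`, and satisfying the base-exchange axiom. -/
def isBaseFamily (E : Finset α) (Bs : Finset (Finset α)) : Prop :=
  Bs.Nonempty ∧ (∀ B ∈ Bs, B ⊆ E) ∧
    ∀ A ∈ Bs, ∀ B ∈ Bs, ∀ a ∈ A \ B, ∃ b ∈ B \ A, insert b (A.erase a) ∈ Bs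

/-- The rank of a subset `A`: the largest intersection of `A` with a basis. -/
def rk (Bs : Finset (Finset α)) (A : Finset α) : ℕ :=
  Bs.sup fun B => (B ∩ A).card

/-- Every element of the ground set lies in some basis. -/
def loopless (E : Finset α) (Bs : Finset (Finset α)) : Prop :=
  ∀ e ∈ E, ∃ B ∈ Bs, e ∈ B

/-- Uniformly dense: `ρ(A) ≤ ρ(E)` for all nonempty `A ⊆ E`, in cross-multiplied form. -/
def uniformlyDense (E : Finset α) (Bs : Finset (Finset α)) : Prop :=
  ∀ A ⊆ E, A.Nonempty → (A.card : ℝ) * (rk Bs E : ℝ) ≤ (E.card : ℝ) * (rk Bs A : ℝ)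

theorem isBaseFamily.card_eq {E : Finset α} {Bs : Finset (Finset α)} (hM : isBaseFamily E Bs)
    {A B : Finset α} (hA : A ∈ Bs) (hB : B ∈ Bs) : A.card = B.card := by
  have exch : Matroid.ExchangeProperty (fun X : Set α => ∃ C ∈ Bs, (C : Set α) = X) := by
    rintro _ _ ⟨C, hC, rfl⟩ ⟨D, hD, rfl⟩ a ha
    obtain ⟨b, hb, h⟩ := hM.2.2 C hC D hD a (by simpa using ha)
    exact ⟨b, by simpa using hb, _, h, by simp⟩
  simpa using exch.encard_isBase_eq ⟨A, hA, rfl⟩ ⟨B, hB, rfl⟩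

theorem card_inter_le_rk {Bs : Finset (Finset α)} {B : Finset α} (hB : B ∈ Bs) (A : Finset α) :
    (B ∩ A).card ≤ rk Bs A :=
  Finset.le_sup (f := fun B => (B ∩ A).card) hB

theorem isBaseFamily.rk_ground {E : Finset α} {Bs : Finset (Finset α)} (hM : isBaseFamily E Bs)
    {B : Finset α} (hB : B ∈ Bs) : rk Bs E = B.card := by
  refine le_antisymm (Finset.sup_le fun C hC => ?_) ?_
  · exact (Finset.card_le_card inter_subset_left).trans_eq (hM.card_eq hC hB)
  · simpa [Finset.inter_eq_left.2 (hM.2.1 B hB)] using card_inter_le_rk hB E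

theorem rk_pos {E : Finset α} {Bs : Finset (Finset α)} (hl : loopless E Bs) {A : Finset α}
    (hA : A ⊆ E) (hne : A.Nonempty) : 0 < rk Bs A := by
  obtain ⟨e, he⟩ := hne
  obtain ⟨B, hB, heB⟩ := hl e (hA he)
  exact (Finset.card_pos.2 ⟨e, mem_inter.2 ⟨heB, he⟩⟩).trans_le (card_inter_le_rk hB A)

/-- A basis meeting `A` in fewer elements than some other basis admits an exchange that brings
an element of `A` in and moves an element outside of `A` out. -/
theorem isBaseFamily.exists_exchange_of_card_inter_lt {E : Finset α} {Bs : Finset (Finset α)}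
    (hM : isBaseFamily E Bs) {A B C : Finset α} (hB : B ∈ Bs) (hC : C ∈ Bs)
    (h : (B ∩ A).card < (C ∩ A).card) :
    ∃ a ∈ B \ A, ∃ b ∈ A \ B, insert b (B.erase a) ∈ Bs := by
  induction hn : (C \ B).card using Nat.strong_induction_on generalizing C with
  | _ n ih =>
  by_cases hCA : C \ B ⊆ A
  · have hcard := hM.card_eq hB hC
    have h1 := card_sdiff_add_card_inter B A
    have h2 := card_sdiff_add_card_inter C A
    obtain ⟨a, haB, haC⟩ := exists_mem_notMem_of_card_lt_card
      (show (C \ A).card < (B \ A).card by omega)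
    rw [mem_sdiff] at haB
    have haC' : a ∉ C := fun h => haC (mem_sdiff.2 ⟨h, haB.2⟩)
    obtain ⟨b, hb, hins⟩ := hM.2.2 B hB C hC a (mem_sdiff.2 ⟨haB.1, haC'⟩)
    exact ⟨a, mem_sdiff.2 haB, b, mem_sdiff.2 ⟨hCA hb, (mem_sdiff.1 hb).2⟩, hins⟩
  · obtain ⟨c, hc, hcA⟩ := not_subset.1 hCA
    obtain ⟨b, hb, hins⟩ := hM.2.2 C hC B hB c hc
    rw [mem_sdiff] at hc hb
    refine ih _ ?_ hins ?_ rfl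
    · rw [← hn]
      refine card_lt_card (ssubset_iff_of_subset ?_ |>.2 ⟨c, mem_sdiff.2 hc, ?_⟩) <;> grind
    · refine h.trans_le (card_le_card ?_)
      grind

/-- There is a basis meeting every superlevel set of `w` in a maximal independent set. -/
theorem isBaseFamily.exists_card_inter_superlevel_eq_rk {E : Finset α} {Bs : Finset (Finset α)}
    (hM : isBaseFamily E Bs) (w : α → ℝ) :
    ∃ B ∈ Bs, ∀ t, (B ∩ {e ∈ E | t < w e}).card = rk Bs {e ∈ E | t < w e} := by
  obtain ⟨B, hB, hmax⟩ := exists_max_image Bs (fun B => ∑ e ∈ B, w e) hM.1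
  refine ⟨B, hB, fun t => (card_inter_le_rk hB _).antisymm (Finset.sup_le fun C hC => ?_)⟩
  by_contra! hlt
  obtain ⟨a, ha, b, hb, hins⟩ := hM.exists_exchange_of_card_inter_lt hB hC hlt
  simp only [mem_sdiff, mem_filter, not_and, not_lt] at ha hb
  have hle := hmax _ hins
  rw [sum_insert (by simp [hb.2])] at hle
  have := add_sum_erase B w ha.1
  have := ha.2 (hM.2.1 B hB ha.1)
  linarith [hb.1.2]

theorem sum_sub_mul_nonneg_of_superlevel {β : Type*} (E : Finset β) (w d : β → ℝ)
    (m : ℝ) (hm : ∀ e ∈ E, m ≤ w e) (h : ∀ t, 0 ≤ ∑ e ∈ E with t < w e, d e) :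
    0 ≤ ∑ e ∈ E, (w e - m) * d e := by
  induction hn : E.card using Nat.strong_induction_on generalizing E m with
  | _ n ih =>
  obtain rfl | hne := E.eq_empty_or_nonempty
  · simp
  obtain ⟨a, ha, hmin⟩ := exists_min_image E w hne
  have hE : 0 ≤ ∑ e ∈ E, d e := by
    have := h (w a - 1)
    rwa [filter_true_of_mem fun e he => by linarith [hmin e he]] at this
  have hrest : 0 ≤ ∑ e ∈ E with w a < w e, (w e - w a) * d e := by
    refine ih _ ?_ _ (w a) (fun e he => (mem_filter.1 he).2.le) (fun t => ?_) rfl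
    · rw [← hn]
      exact card_lt_card (filter_ssubset.2 ⟨a, ha, lt_irrefl _⟩)
    · simpa [filter_filter] using h (max (w a) t)
  have hsum : ∑ e ∈ E with w a < w e, (w e - w a) * d e = ∑ e ∈ E, (w e - w a) * d e := by
    refine sum_filter_of_ne fun e he hne => (hmin e he).lt_of_ne fun heq => hne ?_
    simp [heq]
  have hsplit : ∑ e ∈ E, (w e - m) * d e
      = ∑ e ∈ E, (w e - w a) * d e + (w a - m) * ∑ e ∈ E, d e := by
    rw [mul_sum, ← sum_add_distrib]
    exact sum_congr rfl fun e _ => by ring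
  rw [hsplit, ← hsum]
  exact add_nonneg hrest (mul_nonneg (sub_nonneg.2 (hm a ha)) hE)

theorem sum_mul_nonneg_of_superlevel {β : Type*} (E : Finset β) (w d : β → ℝ)
    (h : ∀ t, 0 ≤ ∑ e ∈ E with t < w e, d e) (h0 : ∑ e ∈ E, d e = 0) :
    0 ≤ ∑ e ∈ E, w e * d e := by
  obtain rfl | hne := E.eq_empty_or_nonempty
  · simp
  obtain ⟨a, -, hmin⟩ := exists_min_image E w hne
  have := sum_sub_mul_nonneg_of_superlevel E w d (w a) hmin h
  simpa [sub_mul, sum_sub_distrib, ← mul_sum, h0] using this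

/-- The base polytope satisfies the rank inequalities. -/
theorem sum_le_rk_of_mem_convexHull {Bs : Finset (Finset α)} {x : α → ℝ}
    (hx : x ∈ convexHull ℝ {x : α → ℝ | ∃ B ∈ Bs, x = fun e => if e ∈ B then (1 : ℝ) else 0})
    (A : Finset α) : ∑ e ∈ A, x e ≤ rk Bs A := by
  have hconv : Convex ℝ {y : α → ℝ | ∑ e ∈ A, y e ≤ rk Bs A} := by
    refine convex_halfSpace_le ⟨fun y z => ?_, fun c y => ?_⟩ _
    · simp [sum_add_distrib]
    · simp [mul_sum]
  refine convexHull_min ?_ hconv hx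
  rintro _ ⟨B, hB, rfl⟩
  have := card_inter_le_rk hB A
  rw [inter_comm] at this
  simpa [filter_mem_eq_inter] using this

/-- The base polytope is cut out by the rank inequalities: a vector
supported on `E` that satisfies the rank inequalities, with equality on `E`, lies in it. -/
theorem isBaseFamily.mem_convexHull_of_sum_le_rk {E : Finset α} {Bs : Finset (Finset α)}
    (hM : isBaseFamily E Bs) {x : α → ℝ} (hsupp : ∀ e ∉ E, x e = 0)
    (hE : ∑ e ∈ E, x e = rk Bs E) (hA : ∀ A ⊆ E, ∑ e ∈ A, x e ≤ rk Bs A) :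
    x ∈ convexHull ℝ {x : α → ℝ | ∃ B ∈ Bs, x = fun e => if e ∈ B then (1 : ℝ) else 0} := by
  by_contra hx
  have hfin : {x : α → ℝ | ∃ B ∈ Bs, x = fun e => if e ∈ B then (1 : ℝ) else 0}.Finite := by
    refine (Bs.finite_toSet.image fun B e => if e ∈ B then (1 : ℝ) else 0).subset ?_
    rintro _ ⟨B, hB, rfl⟩
    exact ⟨B, hB, rfl⟩
  obtain ⟨f, u, hf, hfx⟩ := geometric_hahn_banach_closed_point (convex_convexHull ℝ _)
    (hfin.isClosed_convexHull ℝ) hx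
  set w : α → ℝ := fun e => f (Pi.single e 1) with hw
  have hfsum : ∀ y : α → ℝ, (∀ e ∉ E, y e = 0) → f y = ∑ e ∈ E, w e * y e := by
    intro y hy
    have : y = ∑ e ∈ E, y e • (Pi.single e 1 : α → ℝ) := by
      ext a
      by_cases ha : a ∈ E <;> simp [Pi.single_apply, ha, hy]
    conv_lhs => rw [this]
    simp [hw, mul_comm]
  obtain ⟨B, hB, hBw⟩ := hM.exists_card_inter_superlevel_eq_rk w
  have hBsum : ∀ A : Finset α, ∑ e ∈ A, (if e ∈ B then (1 : ℝ) else 0) = (B ∩ A).card := by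
    intro A
    simp [inter_comm]
  have hnonneg := sum_mul_nonneg_of_superlevel E w (fun e => (if e ∈ B then (1 : ℝ) else 0) - x e)
    (fun t => by
      rw [sum_sub_distrib, hBsum, hBw, sub_nonneg]
      exact hA _ (filter_subset _ _))
    (by rw [sum_sub_distrib, hBsum, hE, inter_eq_left.2 (hM.2.1 B hB), hM.rk_ground hB, sub_self])
  simp only [mul_sub, sum_sub_distrib] at hnonneg
  rw [← hfsum x hsupp, ← hfsum (fun e => if e ∈ B then (1 : ℝ) else 0)
    fun e he => if_neg fun h => he (hM.2.1 B hB h)] at hnonneg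
  linarith [hf _ (subset_convexHull ℝ _ ⟨B, hB, rfl⟩)]

/-- The base polytope of a loopless matroid contains the constant point
`(ρ⁻¹, …, ρ⁻¹)` (with `ρ⁻¹ = rank(M)/|E|` on coordinates of `E`) iff
`ρ(A) ≤ ρ(E)` for all nonempty `A ⊆ E`. -/
theorem constPoint_mem_basePolytope_iff (E : Finset α) (Bs : Finset (Finset α))
    (hM : isBaseFamily E Bs) (hl : loopless E Bs) :
    ((fun e => if e ∈ E then (rk Bs E : ℝ) / (E.card : ℝ) else 0) ∈
        convexHull ℝ {x : α → ℝ | ∃ B ∈ Bs, x = fun e => if e ∈ B then (1 : ℝ) else 0}) ↔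
      (∀ A ⊆ E, A.Nonempty →
        (A.card : ℝ) / (rk Bs A : ℝ) ≤ (E.card : ℝ) / (rk Bs E : ℝ)) := by
  have hsum : ∀ A ⊆ E, ∑ e ∈ A, (if e ∈ E then (rk Bs E : ℝ) / (E.card : ℝ) else 0)
      = A.card * (rk Bs E / E.card) := by
    intro A hA
    rw [sum_congr rfl fun e he => if_pos (hA he), sum_const, nsmul_eq_mul]
  have hdiv : ∀ A ⊆ E, A.Nonempty →
      ((A.card : ℝ) / rk Bs A ≤ E.card / rk Bs E ↔ A.card * (rk Bs E / E.card : ℝ) ≤ rk Bs A) := by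
    intro A hA hne
    have hrA : (0 : ℝ) < rk Bs A := by exact_mod_cast rk_pos hl hA hne
    have hrE : (0 : ℝ) < rk Bs E := by exact_mod_cast rk_pos hl subset_rfl (hne.mono hA)
    have hE : (0 : ℝ) < E.card := by exact_mod_cast card_pos.2 (hne.mono hA)
    rw [div_le_div_iff₀ hrA hrE, mul_div_assoc', div_le_iff₀ hE, mul_comm (E.card : ℝ)]
  constructor
  · intro hx A hA hne
    rw [hdiv A hA hne, ← hsum A hA]
    exact sum_le_rk_of_mem_convexHull hx A
  · intro h
    refine hM.mem_convexHull_of_sum_le_rk (fun e he => if_neg he) ?_ fun A hA => ?_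
    · rw [hsum E subset_rfl]
      obtain rfl | hne := E.eq_empty_or_nonempty
      · have : rk Bs ∅ = 0 := Nat.le_zero.1 (Finset.sup_le fun B _ => by simp)
        simp [this]
      · exact mul_div_cancel₀ _ (by exact_mod_cast hne.card_ne_zero)
    · obtain rfl | hne := A.eq_empty_or_nonempty
      · simp
      · rw [hsum A hA, ← hdiv A hA hne]
        exact h A hA hne
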